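/- Let q be a prime power and n, k, m, r positive integers with k | m, m | r, and r | n. Let γ ∈ F_{q^m}^* be a root of an irreducible polynomial of degree m/k over F_{q^k}, where m/k > 4; let ξ ∈ F_{q^r}^* be a root of an irreducible polynomial of degree r/m over F_{q^m}, where r/m > 4; and let ζ ∈ F_{q^n}^* be a root of an irreducible polynomial of degree n/r over F_{q^r}, where n/r > 2. Let δ_1, δ_2, τ_1, τ_2, η_1, η_2 ∈ F_{q^k}^*. Then U = {δ_1 a + δ_2 a^q ζ + τ_1 u γ + τ_2 u^q γ^2 + η_1 e ξ + η_2 e^q ξ^2 : a, u, e ∈ F_{q^k}} is a Sidon space of F_q-dimension 3k. -/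

import Mathlib

open Submodule Pointwise

set_option maxHeartbeats 1000000
set_option synthInstance.maxHeartbeats 400000

/-- An `F`-subspace `V` of a field `K` is a *Sidon space* if for all nonzero
`a, b, c, d ∈ V` with `a * b = c * d` one has `{aF, bF} = {cF, dF}` (as a pair of
one-dimensional `F`-subspaces). -/
def IsSidonSpace {K : Type*} [Field K] (F : Subfield K) (V : Submodule F K) : Prop :=
  ∀ a ∈ V, ∀ b ∈ V, ∀ c ∈ V, ∀ d ∈ V,
    a ≠ 0 → b ≠ 0 → c ≠ 0 → d ≠ 0 → a * b = c * d →
    ({Submodule.span F {a}, Submodule.span F {b}} : Set (Submodule F K)) =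
      {Submodule.span F {c}, Submodule.span F {d}}

section Proportionality

variable {K ι : Type*} [Field K]

/-- If two products of nonzero linear forms agree, one factor on the right has vanishing
`2 × 2` minors with the first factor on the left. -/
theorem cross_eq_or_of_symm_mul_eq {x x' y y' : ι → K}
    (hdiag : ∀ i, x i * x' i = y i * y' i)
    (hsymm : ∀ i j, x i * x' j + x j * x' i = y i * y' j + y j * y' i) (i : ι) :
    (∀ j, x i * y j = x j * y i) ∨ (∀ j, x i * y' j = x j * y' i) := by
  refine or_iff_not_imp_left.mpr fun h k => ?_
  obtain ⟨j, hj⟩ := not_forall.mp h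
  have hj' : x i * y j - x j * y i ≠ 0 := sub_ne_zero.mpr hj
  have key (j k : ι) : (x i * y j - x j * y i) * (x i * y' k - x k * y' i) +
      (x i * y k - x k * y i) * (x i * y' j - x j * y' i) = 0 := by
    linear_combination (-x i ^ 2) * hsymm j k + x i * x k * hsymm i j + x i * x j * hsymm i k -
      2 * x j * x k * hdiag i
  have hjj : (x i * y j - x j * y i) * (x i * y' j - x j * y' i) = 0 := by
    linear_combination (-x i ^ 2) * hdiag j + x i * x j * hsymm i j - x j ^ 2 * hdiag i
  have hj0 := (mul_eq_zero.mp hjj).resolve_left hj'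
  have hk := key j k
  rw [hj0, mul_zero, add_zero] at hk
  exact sub_eq_zero.mp ((mul_eq_zero.mp hk).resolve_left hj')

theorem exists_scaling_of_cross_eq {x x' y y' : ι → K} {i : ι} (hi : x i ≠ 0) (hy : y ≠ 0)
    (hdiag : ∀ i, x i * x' i = y i * y' i)
    (hsymm : ∀ i j, x i * x' j + x j * x' i = y i * y' j + y j * y' i)
    (hcross : ∀ j, x i * y j = x j * y i) :
    ∃ c : K, c ≠ 0 ∧ (∀ j, x j = c * y j) ∧ ∀ j, y' j = c * x' j := by
  have hyi : y i ≠ 0 := by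
    intro h
    refine hy (funext fun j => ?_)
    simpa [h, hi] using hcross j
  have hx (j : ι) : x j = x i / y i * y j := by
    field_simp
    exact (hcross j).symm
  have hx' : y' i = x i / y i * x' i := by
    field_simp
    linear_combination -hdiag i
  refine ⟨x i / y i, div_ne_zero hi hyi, hx, fun j => ?_⟩
  have h := hsymm i j
  rw [hx j, hx'] at h
  field_simp at h ⊢
  exact mul_left_cancel₀ hyi (by linear_combination -h)

theorem exists_scaling_of_symm_mul_eq {x x' y y' : ι → K} (hx : x ≠ 0) (hy : y ≠ 0) (hy' : y' ≠ 0)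
    (hdiag : ∀ i, x i * x' i = y i * y' i)
    (hsymm : ∀ i j, x i * x' j + x j * x' i = y i * y' j + y j * y' i) :
    (∃ c : K, c ≠ 0 ∧ (∀ j, x j = c * y j) ∧ ∀ j, y' j = c * x' j) ∨
      ∃ c : K, c ≠ 0 ∧ (∀ j, x j = c * y' j) ∧ ∀ j, y j = c * x' j := by
  obtain ⟨i, hi⟩ := Function.ne_iff.mp hx
  refine (cross_eq_or_of_symm_mul_eq hdiag hsymm i).imp
    (exists_scaling_of_cross_eq hi hy hdiag hsymm)
    (exists_scaling_of_cross_eq hi hy' (fun i => ?_) fun i j => ?_)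
  · rw [hdiag, mul_comm]
  · rw [hsymm]
    ring

/-- A twisted relation forces a scaling factor to be fixed by `t ↦ t ^ q`, up to exchanging the
two vectors on the right. -/
theorem exists_fixed_scaling_of_scaling {q : ℕ} {x x' y y' : ι → K} (hy : y ≠ 0) (hy' : y' ≠ 0)
    {c : K} (hc : c ≠ 0) (hx : ∀ j, x j = c * y j) (hx' : ∀ j, y' j = c * x' j)
    (htwist : ∀ i j, x i ^ q * x' j + x' i ^ q * x j = y i ^ q * y' j + y' i ^ q * y j) :
    (∃ t : K, t ≠ 0 ∧ t ^ q = t ∧ (∀ j, x j = t * y j) ∧ ∀ j, y' j = t * x' j) ∨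
      ∃ t : K, t ≠ 0 ∧ t ^ q = t ∧ (∀ j, x j = t * y' j) ∧ ∀ j, y j = t * x' j := by
  refine or_iff_not_imp_left.mpr fun h => ?_
  have hcq : c ^ q ≠ c := fun h' => h ⟨c, hc, h', hx, hx'⟩
  have hrel (i j : ι) : y i ^ q * x' j * c = x' i ^ q * y j * c := by
    have h₁ := htwist i j
    rw [hx, hx, hx', hx', mul_pow, mul_pow] at h₁
    refine mul_left_cancel₀ (sub_ne_zero.mpr hcq) ?_
    linear_combination c * h₁
  obtain ⟨i, hi⟩ := Function.ne_iff.mp hy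
  have hi : y i ≠ 0 := hi
  have hiq : y i ^ q ≠ 0 := pow_ne_zero q hi
  set s := x' i ^ q / y i ^ q with hs
  have hx's (j : ι) : x' j = s * y j := by
    rw [hs]
    field_simp
    exact mul_right_cancel₀ hc (by linear_combination hrel i j)
  have hs0 : s ≠ 0 := by
    intro h0
    exact hy' (funext fun j => by simp [hx', hx's, h0])
  have hsq : s ^ q = s := by
    conv_rhs => rw [hs]
    rw [hx's i, mul_pow]
    field_simp
  refine ⟨s⁻¹, inv_ne_zero hs0, by rw [inv_pow, hsq], fun j => ?_, fun j => ?_⟩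
  · rw [hx', hx's, hx]
    field_simp
  · rw [hx's]
    field_simp

theorem exists_fixed_scaling_of_twisted_mul_eq {q : ℕ} {x x' y y' : ι → K}
    (hx : x ≠ 0) (hy : y ≠ 0) (hy' : y' ≠ 0)
    (hdiag : ∀ i, x i * x' i = y i * y' i)
    (hsymm : ∀ i j, x i * x' j + x j * x' i = y i * y' j + y j * y' i)
    (htwist : ∀ i j, x i ^ q * x' j + x' i ^ q * x j = y i ^ q * y' j + y' i ^ q * y j) :
    (∃ t : K, t ≠ 0 ∧ t ^ q = t ∧ (∀ j, x j = t * y j) ∧ ∀ j, y' j = t * x' j) ∨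
      ∃ t : K, t ≠ 0 ∧ t ^ q = t ∧ (∀ j, x j = t * y' j) ∧ ∀ j, y j = t * x' j := by
  rcases exists_scaling_of_symm_mul_eq hx hy hy' hdiag hsymm with ⟨c, hc, h, h'⟩ | ⟨c, hc, h, h'⟩
  · exact exists_fixed_scaling_of_scaling hy hy' hc h h' htwist
  · refine (exists_fixed_scaling_of_scaling hy' hy hc h h' fun i j => ?_).symm
    rw [htwist, add_comm]

end Proportionality

section Coefficients

variable {K : Type*} [Field K] {L : Subfield K} {z : K}

theorem quadratic_mem (hz : z ∈ L) {a b c : K} (ha : a ∈ L) (hb : b ∈ L) (hc : c ∈ L) :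
    a + b * z + c * z ^ 2 ∈ L :=
  add_mem (add_mem ha (mul_mem hb hz)) (mul_mem hc (pow_mem hz 2))

theorem coeff_eq_zero_of_lt_natDegree_minpoly {N : ℕ} (hz : N < (minpoly L z).natDegree)
    {c : ℕ → K} (hc : ∀ i, c i ∈ L) (h : ∑ i ∈ Finset.range (N + 1), c i * z ^ i = 0) :
    ∀ i ≤ N, c i = 0 := by
  have hli : LinearIndependent L fun i : Fin (N + 1) => z ^ (i : ℕ) :=
    (linearIndependent_pow (K := L) z).comp (Fin.castLE hz) (Fin.castLE_injective hz)
  intro i hi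
  have h' := Fintype.linearIndependent_iff.mp hli (fun i => ⟨c i, hc i⟩)
    (by simpa [Subfield.smul_def, Finset.sum_range] using h) ⟨i, Nat.lt_succ_of_le hi⟩
  exact congrArg Subtype.val h'

theorem quadratic_coeff_eq (hz : 2 < (minpoly L z).natDegree) {a b c a' b' c' : K}
    (ha : a ∈ L) (hb : b ∈ L) (hc : c ∈ L) (ha' : a' ∈ L) (hb' : b' ∈ L) (hc' : c' ∈ L)
    (h : a + b * z + c * z ^ 2 = a' + b' * z + c' * z ^ 2) : a = a' ∧ b = b' ∧ c = c' := by
  have key := coeff_eq_zero_of_lt_natDegree_minpoly hz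
    (c := fun | 0 => a - a' | 1 => b - b' | 2 => c - c' | _ => 0)
    (fun i => by
      match i with
      | 0 => exact sub_mem ha ha'
      | 1 => exact sub_mem hb hb'
      | 2 => exact sub_mem hc hc'
      | _ + 3 => exact zero_mem L)
    (by
      simp only [Finset.sum_range_succ, Finset.sum_range_zero]
      linear_combination h)
  exact ⟨sub_eq_zero.mp (key 0 (by norm_num)), sub_eq_zero.mp (key 1 (by norm_num)),
    sub_eq_zero.mp (key 2 (by norm_num))⟩

theorem quadratic_mul_coeff_eq (hz : 4 < (minpoly L z).natDegree)
    {a₀ a₁ a₂ b₀ b₁ b₂ c₀ c₁ c₂ d₀ d₁ d₂ : K}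
    (ha₀ : a₀ ∈ L) (ha₁ : a₁ ∈ L) (ha₂ : a₂ ∈ L) (hb₀ : b₀ ∈ L) (hb₁ : b₁ ∈ L) (hb₂ : b₂ ∈ L)
    (hc₀ : c₀ ∈ L) (hc₁ : c₁ ∈ L) (hc₂ : c₂ ∈ L) (hd₀ : d₀ ∈ L) (hd₁ : d₁ ∈ L) (hd₂ : d₂ ∈ L)
    (h : (a₀ + a₁ * z + a₂ * z ^ 2) * (b₀ + b₁ * z + b₂ * z ^ 2) =
      (c₀ + c₁ * z + c₂ * z ^ 2) * (d₀ + d₁ * z + d₂ * z ^ 2)) :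
    a₀ * b₀ = c₀ * d₀ ∧ a₀ * b₁ + a₁ * b₀ = c₀ * d₁ + c₁ * d₀ ∧
      a₀ * b₂ + a₁ * b₁ + a₂ * b₀ = c₀ * d₂ + c₁ * d₁ + c₂ * d₀ ∧
      a₁ * b₂ + a₂ * b₁ = c₁ * d₂ + c₂ * d₁ ∧ a₂ * b₂ = c₂ * d₂ := by
  have key := coeff_eq_zero_of_lt_natDegree_minpoly hz
    (c := fun
      | 0 => a₀ * b₀ - c₀ * d₀
      | 1 => a₀ * b₁ + a₁ * b₀ - (c₀ * d₁ + c₁ * d₀)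
      | 2 => a₀ * b₂ + a₁ * b₁ + a₂ * b₀ - (c₀ * d₂ + c₁ * d₁ + c₂ * d₀)
      | 3 => a₁ * b₂ + a₂ * b₁ - (c₁ * d₂ + c₂ * d₁)
      | 4 => a₂ * b₂ - c₂ * d₂
      | _ => 0)
    (fun i => by
      match i with
      | 0 | 1 | 2 | 3 | 4 =>
        simp only
        repeat' first | assumption | apply sub_mem | apply add_mem | apply mul_mem
      | _ + 5 => exact zero_mem L)
    (by
      simp only [Finset.sum_range_succ, Finset.sum_range_zero]
      linear_combination h)
  exact ⟨sub_eq_zero.mp (key 0 (by norm_num)), sub_eq_zero.mp (key 1 (by norm_num)),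
    sub_eq_zero.mp (key 2 (by norm_num)), sub_eq_zero.mp (key 3 (by norm_num)),
    sub_eq_zero.mp (key 4 (by norm_num))⟩

end Coefficients

theorem Subfield.mem_of_pow_natCard_eq {K : Type*} [Field K] (F : Subfield K) [Finite F] {t : K}
    (ht : t ^ Nat.card F = t) : t ∈ F := by
  have := Fintype.ofFinite F
  rw [Nat.card_eq_fintype_card] at ht
  have hroots := FiniteField.roots_X_pow_card_sub_X F
  have hsplit : ((Polynomial.X ^ Fintype.card F - Polynomial.X : Polynomial F)).Splits := by
    rw [Polynomial.splits_iff_card_roots, hroots,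
      FiniteField.X_pow_card_sub_X_natDegree_eq F Fintype.one_lt_card]
    rfl
  exact hsplit.mem_subfield_of_isRoot F
    (FiniteField.X_pow_card_sub_X_ne_zero F Fintype.one_lt_card) (by simp [ht])

section Generators

variable {K : Type*} [Field K] {q : ℕ} {Fk Fm Fr : Subfield K} {γ ξ ζ δ₁ δ₂ τ₁ τ₂ η₁ η₂ : K}

/-- The element with coordinates `v = (a, u, e)`. -/
def generatorCombination (q : ℕ) (γ ξ ζ δ₁ δ₂ τ₁ τ₂ η₁ η₂ : K) (v : Fin 3 → K) : K :=
  δ₁ * v 0 + δ₂ * v 0 ^ q * ζ + τ₁ * v 1 * γ + τ₂ * v 1 ^ q * γ ^ 2 + η₁ * v 2 * ξ +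
    η₂ * v 2 ^ q * ξ ^ 2

theorem generatorCombination_eq (v : Fin 3 → K) :
    generatorCombination q γ ξ ζ δ₁ δ₂ τ₁ τ₂ η₁ η₂ v =
      ((δ₁ * v 0 + τ₁ * v 1 * γ + τ₂ * v 1 ^ q * γ ^ 2) + η₁ * v 2 * ξ + η₂ * v 2 ^ q * ξ ^ 2) +
        δ₂ * v 0 ^ q * ζ := by
  unfold generatorCombination
  ring

theorem generatorCombination_injOn (hFkFm : Fk ≤ Fm) (hFmFr : Fm ≤ Fr) (hγFm : γ ∈ Fm)
    (hξFr : ξ ∈ Fr) (hγ : 4 < (minpoly Fk γ).natDegree) (hξ : 4 < (minpoly Fm ξ).natDegree)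
    (hζ : 2 < (minpoly Fr ζ).natDegree)
    (hδ₁ : δ₁ ∈ Fk) (hδ₂ : δ₂ ∈ Fk) (hτ₁ : τ₁ ∈ Fk) (hτ₂ : τ₂ ∈ Fk)
    (hη₁ : η₁ ∈ Fk) (hη₂ : η₂ ∈ Fk)
    (hδ₁0 : δ₁ ≠ 0) (hτ₁0 : τ₁ ≠ 0) (hη₁0 : η₁ ≠ 0) {x y : Fin 3 → K}
    (hx : ∀ i, x i ∈ Fk) (hy : ∀ i, y i ∈ Fk)
    (h : generatorCombination q γ ξ ζ δ₁ δ₂ τ₁ τ₂ η₁ η₂ x =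
      generatorCombination q γ ξ ζ δ₁ δ₂ τ₁ τ₂ η₁ η₂ y) : x = y := by
  have lin (α : K) (hα : α ∈ Fk) (v : Fin 3 → K) (hv : ∀ i, v i ∈ Fk) (i : Fin 3) :
      α * v i ∈ Fk := mul_mem hα (hv i)
  have pw (α : K) (hα : α ∈ Fk) (v : Fin 3 → K) (hv : ∀ i, v i ∈ Fk) (i : Fin 3) :
      α * v i ^ q ∈ Fk := mul_mem hα (pow_mem (hv i) q)
  have low (v : Fin 3 → K) (hv : ∀ i, v i ∈ Fk) :
      δ₁ * v 0 + τ₁ * v 1 * γ + τ₂ * v 1 ^ q * γ ^ 2 ∈ Fm :=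
    quadratic_mem hγFm (hFkFm (lin _ hδ₁ v hv 0)) (hFkFm (lin _ hτ₁ v hv 1))
      (hFkFm (pw _ hτ₂ v hv 1))
  have mid (v : Fin 3 → K) (hv : ∀ i, v i ∈ Fk) :
      (δ₁ * v 0 + τ₁ * v 1 * γ + τ₂ * v 1 ^ q * γ ^ 2) + η₁ * v 2 * ξ + η₂ * v 2 ^ q * ξ ^ 2 ∈ Fr :=
    quadratic_mem hξFr (hFmFr (low v hv)) (hFmFr (hFkFm (lin _ hη₁ v hv 2)))
      (hFmFr (hFkFm (pw _ hη₂ v hv 2)))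
  rw [generatorCombination_eq, generatorCombination_eq] at h
  obtain ⟨h₀, -, -⟩ := quadratic_coeff_eq hζ (mid x hx) (hFmFr (hFkFm (pw _ hδ₂ x hx 0)))
    (zero_mem Fr) (mid y hy) (hFmFr (hFkFm (pw _ hδ₂ y hy 0))) (zero_mem Fr)
    (by linear_combination h)
  obtain ⟨h₀₀, h₂, -⟩ := quadratic_coeff_eq (by omega) (low x hx) (hFkFm (lin _ hη₁ x hx 2))
    (hFkFm (pw _ hη₂ x hx 2)) (low y hy) (hFkFm (lin _ hη₁ y hy 2)) (hFkFm (pw _ hη₂ y hy 2)) h₀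
  obtain ⟨h₀', h₁, -⟩ := quadratic_coeff_eq (by omega) (lin _ hδ₁ x hx 0) (lin _ hτ₁ x hx 1)
    (pw _ hτ₂ x hx 1) (lin _ hδ₁ y hy 0) (lin _ hτ₁ y hy 1) (pw _ hτ₂ y hy 1) h₀₀
  funext i
  fin_cases i
  · exact mul_left_cancel₀ hδ₁0 h₀'
  · exact mul_left_cancel₀ hτ₁0 h₁
  · exact mul_left_cancel₀ hη₁0 h₂

theorem generatorCombination_mul_relations (hFkFm : Fk ≤ Fm) (hFmFr : Fm ≤ Fr) (hγFm : γ ∈ Fm)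
    (hξFr : ξ ∈ Fr) (hγ : 4 < (minpoly Fk γ).natDegree) (hξ : 4 < (minpoly Fm ξ).natDegree)
    (hζ : 2 < (minpoly Fr ζ).natDegree)
    (hδ₁ : δ₁ ∈ Fk) (hδ₂ : δ₂ ∈ Fk) (hτ₁ : τ₁ ∈ Fk) (hτ₂ : τ₂ ∈ Fk)
    (hη₁ : η₁ ∈ Fk) (hη₂ : η₂ ∈ Fk)
    (hδ₁0 : δ₁ ≠ 0) (hδ₂0 : δ₂ ≠ 0) (hτ₁0 : τ₁ ≠ 0) (hτ₂0 : τ₂ ≠ 0)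
    (hη₁0 : η₁ ≠ 0) (hη₂0 : η₂ ≠ 0) (hq : Function.Injective fun t : K => t ^ q)
    {x x' y y' : Fin 3 → K} (hx : ∀ i, x i ∈ Fk) (hx' : ∀ i, x' i ∈ Fk) (hy : ∀ i, y i ∈ Fk)
    (hy' : ∀ i, y' i ∈ Fk)
    (h : generatorCombination q γ ξ ζ δ₁ δ₂ τ₁ τ₂ η₁ η₂ x *
        generatorCombination q γ ξ ζ δ₁ δ₂ τ₁ τ₂ η₁ η₂ x' =
      generatorCombination q γ ξ ζ δ₁ δ₂ τ₁ τ₂ η₁ η₂ y *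
        generatorCombination q γ ξ ζ δ₁ δ₂ τ₁ τ₂ η₁ η₂ y') :
    (∀ i, x i * x' i = y i * y' i) ∧
      (∀ i j, x i * x' j + x j * x' i = y i * y' j + y j * y' i) ∧
      ∀ i j, x i ^ q * x' j + x' i ^ q * x j = y i ^ q * y' j + y' i ^ q * y j := by
  have lin (α : K) (hα : α ∈ Fk) (v : Fin 3 → K) (hv : ∀ i, v i ∈ Fk) (i : Fin 3) :
      α * v i ∈ Fk := mul_mem hα (hv i)
  have pw (α : K) (hα : α ∈ Fk) (v : Fin 3 → K) (hv : ∀ i, v i ∈ Fk) (i : Fin 3) :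
      α * v i ^ q ∈ Fk := mul_mem hα (pow_mem (hv i) q)
  have low (v : Fin 3 → K) (hv : ∀ i, v i ∈ Fk) :
      δ₁ * v 0 + τ₁ * v 1 * γ + τ₂ * v 1 ^ q * γ ^ 2 ∈ Fm :=
    quadratic_mem hγFm (hFkFm (lin _ hδ₁ v hv 0)) (hFkFm (lin _ hτ₁ v hv 1))
      (hFkFm (pw _ hτ₂ v hv 1))
  have mid (v : Fin 3 → K) (hv : ∀ i, v i ∈ Fk) :
      (δ₁ * v 0 + τ₁ * v 1 * γ + τ₂ * v 1 ^ q * γ ^ 2) + η₁ * v 2 * ξ + η₂ * v 2 ^ q * ξ ^ 2 ∈ Fr :=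
    quadratic_mem hξFr (hFmFr (low v hv)) (hFmFr (hFkFm (lin _ hη₁ v hv 2)))
      (hFmFr (hFkFm (pw _ hη₂ v hv 2)))
  have top (v : Fin 3 → K) (hv : ∀ i, v i ∈ Fk) : δ₂ * v 0 ^ q ∈ Fr :=
    hFmFr (hFkFm (pw _ hδ₂ v hv 0))
  have mlin (α : K) (hα : α ∈ Fk) (v : Fin 3 → K) (hv : ∀ i, v i ∈ Fk) (i : Fin 3) :
      α * v i ∈ Fm := hFkFm (lin α hα v hv i)
  have mpw (α : K) (hα : α ∈ Fk) (v : Fin 3 → K) (hv : ∀ i, v i ∈ Fk) (i : Fin 3) :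
      α * v i ^ q ∈ Fm := hFkFm (pw α hα v hv i)
  simp only [generatorCombination_eq] at h
  obtain ⟨Z₀, Z₁, -⟩ := quadratic_coeff_eq hζ (mul_mem (mid x hx) (mid x' hx'))
    (add_mem (mul_mem (mid x hx) (top x' hx')) (mul_mem (top x hx) (mid x' hx')))
    (mul_mem (top x hx) (top x' hx')) (mul_mem (mid y hy) (mid y' hy'))
    (add_mem (mul_mem (mid y hy) (top y' hy')) (mul_mem (top y hy) (mid y' hy')))
    (mul_mem (top y hy) (top y' hy')) (by linear_combination h)
  obtain ⟨X₀, X₁, X₂, X₃, X₄⟩ := quadratic_mul_coeff_eq hξ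
    (low x hx) (mlin _ hη₁ x hx 2) (mpw _ hη₂ x hx 2)
    (low x' hx') (mlin _ hη₁ x' hx' 2) (mpw _ hη₂ x' hx' 2)
    (low y hy) (mlin _ hη₁ y hy 2) (mpw _ hη₂ y hy 2)
    (low y' hy') (mlin _ hη₁ y' hy' 2) (mpw _ hη₂ y' hy' 2) Z₀
  have cross (α : K) (hα : α ∈ Fm) (β : K) (hβ : β ∈ Fm) (α' : K) (hα' : α' ∈ Fm) (β' : K)
      (hβ' : β' ∈ Fm) : α * β + α' * β' ∈ Fm := add_mem (mul_mem hα hβ) (mul_mem hα' hβ')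
  have crossk (α : K) (hα : α ∈ Fk) (β : K) (hβ : β ∈ Fk) (α' : K) (hα' : α' ∈ Fk) (β' : K)
      (hβ' : β' ∈ Fk) : α * β + α' * β' ∈ Fk := add_mem (mul_mem hα hβ) (mul_mem hα' hβ')
  obtain ⟨W₀, W₁, -⟩ := quadratic_coeff_eq (L := Fm) (z := ξ) (by omega)
    (cross _ (low x hx) _ (mpw _ hδ₂ x' hx' 0) _ (low x' hx') _ (mpw _ hδ₂ x hx 0))
    (cross _ (mlin _ hη₁ x hx 2) _ (mpw _ hδ₂ x' hx' 0)
      _ (mlin _ hη₁ x' hx' 2) _ (mpw _ hδ₂ x hx 0))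
    (cross _ (mpw _ hη₂ x hx 2) _ (mpw _ hδ₂ x' hx' 0)
      _ (mpw _ hη₂ x' hx' 2) _ (mpw _ hδ₂ x hx 0))
    (cross _ (low y hy) _ (mpw _ hδ₂ y' hy' 0) _ (low y' hy') _ (mpw _ hδ₂ y hy 0))
    (cross _ (mlin _ hη₁ y hy 2) _ (mpw _ hδ₂ y' hy' 0)
      _ (mlin _ hη₁ y' hy' 2) _ (mpw _ hδ₂ y hy 0))
    (cross _ (mpw _ hη₂ y hy 2) _ (mpw _ hδ₂ y' hy' 0)
      _ (mpw _ hη₂ y' hy' 2) _ (mpw _ hδ₂ y hy 0))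
    (by linear_combination Z₁)
  have lowcross (α α' β β' : K) (hα : α ∈ Fk) (hα' : α' ∈ Fk) (hβ : β ∈ Fk) (hβ' : β' ∈ Fk)
      (hE : (δ₁ * x 0 + τ₁ * x 1 * γ + τ₂ * x 1 ^ q * γ ^ 2) * α' +
          (δ₁ * x' 0 + τ₁ * x' 1 * γ + τ₂ * x' 1 ^ q * γ ^ 2) * α =
        (δ₁ * y 0 + τ₁ * y 1 * γ + τ₂ * y 1 ^ q * γ ^ 2) * β' +
          (δ₁ * y' 0 + τ₁ * y' 1 * γ + τ₂ * y' 1 ^ q * γ ^ 2) * β) :=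
    quadratic_coeff_eq (L := Fk) (z := γ) (by omega)
      (crossk _ (lin _ hδ₁ x hx 0) _ hα' _ (lin _ hδ₁ x' hx' 0) _ hα)
      (crossk _ (lin _ hτ₁ x hx 1) _ hα' _ (lin _ hτ₁ x' hx' 1) _ hα)
      (crossk _ (pw _ hτ₂ x hx 1) _ hα' _ (pw _ hτ₂ x' hx' 1) _ hα)
      (crossk _ (lin _ hδ₁ y hy 0) _ hβ' _ (lin _ hδ₁ y' hy' 0) _ hβ)
      (crossk _ (lin _ hτ₁ y hy 1) _ hβ' _ (lin _ hτ₁ y' hy' 1) _ hβ)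
      (crossk _ (pw _ hτ₂ y hy 1) _ hβ' _ (pw _ hτ₂ y' hy' 1) _ hβ)
      (by linear_combination hE)
  obtain ⟨V₀, V₁, -⟩ := lowcross _ _ _ _ (pw _ hδ₂ x hx 0) (pw _ hδ₂ x' hx' 0)
    (pw _ hδ₂ y hy 0) (pw _ hδ₂ y' hy' 0) W₀
  obtain ⟨G₀, G₁, G₂, G₃, G₄⟩ := quadratic_mul_coeff_eq hγ
    (lin _ hδ₁ x hx 0) (lin _ hτ₁ x hx 1) (pw _ hτ₂ x hx 1)
    (lin _ hδ₁ x' hx' 0) (lin _ hτ₁ x' hx' 1) (pw _ hτ₂ x' hx' 1)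
    (lin _ hδ₁ y hy 0) (lin _ hτ₁ y hy 1) (pw _ hτ₂ y hy 1)
    (lin _ hδ₁ y' hy' 0) (lin _ hτ₁ y' hy' 1) (pw _ hτ₂ y' hy' 1) X₀
  obtain ⟨A₀, A₁, A₂⟩ := lowcross _ _ _ _ (lin _ hη₁ x hx 2) (lin _ hη₁ x' hx' 2)
    (lin _ hη₁ y hy 2) (lin _ hη₁ y' hy' 2) (by linear_combination X₁)
  have d₀ : x 0 * x' 0 = y 0 * y' 0 :=
    mul_left_cancel₀ (mul_ne_zero hδ₁0 hδ₁0) (by linear_combination G₀)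
  have d₁ : x 1 * x' 1 = y 1 * y' 1 := by
    refine hq (mul_left_cancel₀ (mul_ne_zero hτ₂0 hτ₂0) ?_)
    simp only [mul_pow]
    linear_combination G₄
  have d₂ : x 2 * x' 2 = y 2 * y' 2 := by
    refine hq (mul_left_cancel₀ (mul_ne_zero hη₂0 hη₂0) ?_)
    simp only [mul_pow]
    linear_combination X₄
  obtain ⟨B₀, B₁, -⟩ := lowcross _ _ _ _ (pw _ hη₂ x hx 2) (pw _ hη₂ x' hx' 2)
    (pw _ hη₂ y hy 2) (pw _ hη₂ y' hy' 2) (by linear_combination X₂ - η₁ ^ 2 * d₂)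
  have s₀₁ : x 0 * x' 1 + x 1 * x' 0 = y 0 * y' 1 + y 1 * y' 0 :=
    mul_left_cancel₀ (mul_ne_zero hδ₁0 hτ₁0) (by linear_combination G₁)
  have s₀₂ : x 0 * x' 2 + x 2 * x' 0 = y 0 * y' 2 + y 2 * y' 0 :=
    mul_left_cancel₀ (mul_ne_zero hδ₁0 hη₁0) (by linear_combination A₀)
  have s₁₂ : x 1 * x' 2 + x 2 * x' 1 = y 1 * y' 2 + y 2 * y' 1 :=
    mul_left_cancel₀ (mul_ne_zero hτ₁0 hη₁0) (by linear_combination A₁)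
  have t₀₀ : x 0 ^ q * x' 0 + x' 0 ^ q * x 0 = y 0 ^ q * y' 0 + y' 0 ^ q * y 0 :=
    mul_left_cancel₀ (mul_ne_zero hδ₂0 hδ₁0) (by linear_combination V₀)
  have t₀₁ : x 0 ^ q * x' 1 + x' 0 ^ q * x 1 = y 0 ^ q * y' 1 + y' 0 ^ q * y 1 :=
    mul_left_cancel₀ (mul_ne_zero hδ₂0 hτ₁0) (by linear_combination V₁)
  have t₀₂ : x 0 ^ q * x' 2 + x' 0 ^ q * x 2 = y 0 ^ q * y' 2 + y' 0 ^ q * y 2 :=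
    mul_left_cancel₀ (mul_ne_zero hδ₂0 hη₁0) (by linear_combination W₁)
  have t₁₀ : x 1 ^ q * x' 0 + x' 1 ^ q * x 0 = y 1 ^ q * y' 0 + y' 1 ^ q * y 0 :=
    mul_left_cancel₀ (mul_ne_zero hτ₂0 hδ₁0) (by linear_combination G₂ - τ₁ ^ 2 * d₁)
  have t₁₁ : x 1 ^ q * x' 1 + x' 1 ^ q * x 1 = y 1 ^ q * y' 1 + y' 1 ^ q * y 1 :=
    mul_left_cancel₀ (mul_ne_zero hτ₂0 hτ₁0) (by linear_combination G₃)
  have t₁₂ : x 1 ^ q * x' 2 + x' 1 ^ q * x 2 = y 1 ^ q * y' 2 + y' 1 ^ q * y 2 :=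
    mul_left_cancel₀ (mul_ne_zero hτ₂0 hη₁0) (by linear_combination A₂)
  have t₂₀ : x 2 ^ q * x' 0 + x' 2 ^ q * x 0 = y 2 ^ q * y' 0 + y' 2 ^ q * y 0 :=
    mul_left_cancel₀ (mul_ne_zero hη₂0 hδ₁0) (by linear_combination B₀)
  have t₂₁ : x 2 ^ q * x' 1 + x' 2 ^ q * x 1 = y 2 ^ q * y' 1 + y' 2 ^ q * y 1 :=
    mul_left_cancel₀ (mul_ne_zero hη₂0 hτ₁0) (by linear_combination B₁)
  have t₂₂ : x 2 ^ q * x' 2 + x' 2 ^ q * x 2 = y 2 ^ q * y' 2 + y' 2 ^ q * y 2 :=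
    mul_left_cancel₀ (mul_ne_zero hη₂0 hη₁0) (by linear_combination X₃)
  refine ⟨?_, ?_, ?_⟩
  · intro i
    fin_cases i <;> assumption
  · intro i j
    match i, j with
    | 0, 0 => rw [d₀]
    | 0, 1 => exact s₀₁
    | 0, 2 => exact s₀₂
    | 1, 0 => linear_combination s₀₁
    | 1, 1 => rw [d₁]
    | 1, 2 => exact s₁₂
    | 2, 0 => linear_combination s₀₂
    | 2, 1 => linear_combination s₁₂
    | 2, 2 => rw [d₂]
  · intro i j
    fin_cases i <;> fin_cases j <;> assumption

end Generators

/-- For `k ∣ m ∣ r ∣ n`, with `γ ∈ F_{q^m}^*` of degree `m/k > 4` over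
`F_{q^k}`, `ξ ∈ F_{q^r}^*` of degree `r/m > 4` over `F_{q^m}`, and `ζ ∈ F_{q^n}^*` of
degree `n/r > 2` over `F_{q^r}`, the indicated set is a Sidon space of dimension `3k`. -/
theorem sidonSpace_three_generators_16 {K : Type*} [Field K] (q n k m r : ℕ)
    (hq : IsPrimePow q) (hn : 0 < n) (hk : 0 < k) (hm : 0 < m) (hr : 0 < r)
    (hkm : k ∣ m) (hmr : m ∣ r) (hrn : r ∣ n)
    (hK : Nat.card K = q ^ n)
    (F : Subfield K) (hF : Nat.card F = q)
    (Fk : Subfield K) (hFk : Nat.card Fk = q ^ k) (hFFk : F ≤ Fk)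
    (Fm : Subfield K) (hFm : Nat.card Fm = q ^ m) (hFkFm : Fk ≤ Fm)
    (Fr : Subfield K) (hFr : Nat.card Fr = q ^ r) (hFmFr : Fm ≤ Fr)
    (γ : K) (hγFm : γ ∈ Fm) (hγ : γ ≠ 0)
    (hdegγ : (minpoly Fk γ).natDegree = m / k) (hdegγ' : 4 < m / k)
    (ξ : K) (hξFr : ξ ∈ Fr) (hξ : ξ ≠ 0)
    (hdegξ : (minpoly Fm ξ).natDegree = r / m) (hdegξ' : 4 < r / m)
    (ζ : K) (hζ : ζ ≠ 0)
    (hdegζ : (minpoly Fr ζ).natDegree = n / r) (hdegζ' : 2 < n / r)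
    (δ₁ δ₂ τ₁ τ₂ η₁ η₂ : K)
    (hδ₁ : δ₁ ∈ Fk) (hδ₂ : δ₂ ∈ Fk) (hτ₁ : τ₁ ∈ Fk) (hτ₂ : τ₂ ∈ Fk)
    (hη₁ : η₁ ∈ Fk) (hη₂ : η₂ ∈ Fk)
    (hδ₁0 : δ₁ ≠ 0) (hδ₂0 : δ₂ ≠ 0) (hτ₁0 : τ₁ ≠ 0) (hτ₂0 : τ₂ ≠ 0)
    (hη₁0 : η₁ ≠ 0) (hη₂0 : η₂ ≠ 0) :
    IsSidonSpace F
        (Submodule.span F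
          {x : K | ∃ a ∈ Fk, ∃ u ∈ Fk, ∃ e ∈ Fk,
            x = δ₁ * a + δ₂ * a ^ q * ζ + τ₁ * u * γ + τ₂ * u ^ q * γ ^ 2 + η₁ * e * ξ + η₂ * e ^ q * ξ ^ 2}) ∧
      Module.finrank F
        ↥(Submodule.span F
          {x : K | ∃ a ∈ Fk, ∃ u ∈ Fk, ∃ e ∈ Fk,
            x = δ₁ * a + δ₂ * a ^ q * ζ + τ₁ * u * γ + τ₂ * u ^ q * γ ^ 2 + η₁ * e * ξ + η₂ * e ^ q * ξ ^ 2}) = 3 * k := by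
  have hq1 : 1 < q := hq.one_lt
  have : Finite K := Nat.finite_of_card_ne_zero (by rw [hK]; positivity)
  have : Fintype F := Fintype.ofFinite F
  have hFq : Fintype.card F = q := by rw [← Nat.card_eq_fintype_card, hF]
  have hφ (t : K) : FiniteField.frobeniusAlgHom F K t = t ^ q := by
    rw [FiniteField.coe_frobeniusAlgHom, hFq]
  have hadd (s t : K) : (s + t) ^ q = s ^ q + t ^ q := by
    simp only [← hφ, map_add]
  have hinj : Function.Injective fun t : K => t ^ q := fun s t h =>
    (FiniteField.frobeniusAlgHom F K).toRingHom.injective ((hφ s).trans (h.trans (hφ t).symm))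
  have hfix (t : K) (ht : t ∈ F) : t ^ q = t := by
    have h := (FiniteField.frobeniusAlgHom F K).commutes ⟨t, ht⟩
    rwa [hφ] at h
  have hmemF (t : K) (ht : t ^ q = t) : t ∈ F := F.mem_of_pow_natCard_eq (by rwa [hF])
  set g := generatorCombination q γ ξ ζ δ₁ δ₂ τ₁ τ₂ η₁ η₂ with hg
  have hgadd (v w : Fin 3 → K) : g (v + w) = g v + g w := by
    simp only [hg, generatorCombination, Pi.add_apply, hadd]
    ring
  have hgsmul (t : K) (ht : t ^ q = t) (v : Fin 3 → K) : g (t • v) = t * g v := by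
    simp only [hg, generatorCombination, Pi.smul_apply, smul_eq_mul, mul_pow, ht]
    ring
  have hgzero : g 0 = 0 := by
    simpa [hfix 0 F.zero_mem] using hgsmul 0 (hfix 0 F.zero_mem) 0
  set V : Submodule F K :=
    { carrier := {z | ∃ v : Fin 3 → K, (∀ i, v i ∈ Fk) ∧ z = g v}
      zero_mem' := ⟨0, fun _ => Fk.zero_mem, hgzero.symm⟩
      add_mem' := by
        rintro _ _ ⟨v, hv, rfl⟩ ⟨w, hw, rfl⟩
        exact ⟨v + w, fun i => add_mem (hv i) (hw i), (hgadd v w).symm⟩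
      smul_mem' := by
        rintro t _ ⟨v, hv, rfl⟩
        exact ⟨(t : K) • v, fun i => mul_mem (hFFk t.2) (hv i),
          (hgsmul t (hfix t t.2) v).symm⟩ }
  have hspan : Submodule.span F
      {x : K | ∃ a ∈ Fk, ∃ u ∈ Fk, ∃ e ∈ Fk,
        x = δ₁ * a + δ₂ * a ^ q * ζ + τ₁ * u * γ + τ₂ * u ^ q * γ ^ 2 + η₁ * e * ξ +
          η₂ * e ^ q * ξ ^ 2} = V := by
    rw [← Submodule.span_eq V]
    congr 1
    ext z
    constructor
    · rintro ⟨a, ha, u, hu, e, he, rfl⟩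
      refine ⟨![a, u, e], fun i => ?_, rfl⟩
      fin_cases i <;> assumption
    · rintro ⟨v, hv, rfl⟩
      exact ⟨v 0, hv 0, v 1, hv 1, v 2, hv 2, rfl⟩
  rw [hspan]
  rw [← hdegγ] at hdegγ'
  rw [← hdegξ] at hdegξ'
  rw [← hdegζ] at hdegζ'
  have hginj {v w : Fin 3 → K} (hv : ∀ i, v i ∈ Fk) (hw : ∀ i, w i ∈ Fk) (h : g v = g w) :
      v = w :=
    generatorCombination_injOn hFkFm hFmFr hγFm hξFr hdegγ' hdegξ' hdegζ' hδ₁ hδ₂ hτ₁ hτ₂ hη₁ hη₂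
      hδ₁0 hτ₁0 hη₁0 hv hw h
  constructor
  · rintro _ ⟨x, hx, rfl⟩ _ ⟨x', hx', rfl⟩ _ ⟨y, hy, rfl⟩ _ ⟨y', hy', rfl⟩ hx0 - hy0 hy'0 h
    have hne {v : Fin 3 → K} (hv : g v ≠ 0) : v ≠ 0 := fun h0 => hv (h0 ▸ hgzero)
    obtain ⟨hdiag, hsymm, htwist⟩ := generatorCombination_mul_relations hFkFm hFmFr hγFm hξFr
      hdegγ' hdegξ' hdegζ' hδ₁ hδ₂ hτ₁ hτ₂ hη₁ hη₂ hδ₁0 hδ₂0 hτ₁0 hτ₂0 hη₁0 hη₂0 hinj hx hx' hy hy' h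
    have hspan_eq {v w : Fin 3 → K} {t : K} (ht : t ≠ 0) (htq : t ^ q = t)
        (hvw : ∀ j, v j = t * w j) : Submodule.span F {g v} = Submodule.span F {g w} := by
      have hv : v = t • w := funext hvw
      have hu : IsUnit (⟨t, hmemF t htq⟩ : F) :=
        isUnit_iff_ne_zero.mpr fun h0 => ht (congrArg Subtype.val h0)
      rw [hv, hgsmul t htq]
      exact Submodule.span_singleton_smul_eq hu (g w)
    rcases exists_fixed_scaling_of_twisted_mul_eq (hne hx0) (hne hy0) (hne hy'0) hdiag hsymm htwist
      with ⟨t, ht, htq, h₁, h₂⟩ | ⟨t, ht, htq, h₁, h₂⟩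
    · rw [hspan_eq ht htq h₁, hspan_eq ht htq h₂]
    · rw [hspan_eq ht htq h₁, hspan_eq ht htq h₂, Set.pair_comm]
  · let f : (Fin 3 → Fk) → V := fun v => ⟨g fun i => v i, fun i => v i, fun i => (v i).2, rfl⟩
    have hf : Function.Bijective f := by
      refine ⟨fun v w h => ?_, ?_⟩
      · have h' := hginj (fun i => (v i).2) (fun i => (w i).2) (congrArg Subtype.val h)
        exact funext fun i => Subtype.ext (congrFun h' i)
      · rintro ⟨_, v, hv, rfl⟩
        exact ⟨fun i => ⟨v i, hv i⟩, rfl⟩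
    have hcard := Nat.card_eq_of_bijective f hf
    rw [Nat.card_fun, hFk, Nat.card_fin, Module.natCard_eq_pow_finrank (K := F), hF,
      ← pow_mul] at hcard
    rw [mul_comm 3 k]
    exact (Nat.pow_right_injective hq1 hcard).symm
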